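/- Let N be a positive integer and let W be a finite multiset of positive integers whose set of distinct elements is {a_1,...,a_N} with a_1 < ... < a_N, where a_i occurs in W with multiplicity m_i ≥ 1. Assume gcd(a_1,...,a_N) = 1, and assume W ≡ -W (mod a_i) for every i in {1,...,N}. Then a_i = i for every i in {1,...,N}. -/

import Mathlib

/-- For a multiset `W` of natural numbers and a modulus `d`, the condition
`W ≡ -W (mod d)`: for every residue `r` modulo `d`, the number of elements of
`W` (with multiplicity) congruent to `r` equals the number congruent to `-r`.
This is expressed as: the multiset of residues of `W` modulo `d` is invariant
under negation. -/
def ModSymm (W : Multiset ℕ) (d : ℕ) : Prop :=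
  W.map (fun x => ((x : ZMod d))) = W.map (fun x => (-(x : ZMod d)))

theorem modSymm_iff {W : Multiset ℕ} {d : ℕ} :
    ModSymm W d ↔ W.map (fun x : ℕ => (x : ZMod d)) = W.map (fun x : ℕ => -(x : ZMod d)) := by
  simp [ModSymm, Multiset.bind_def, Multiset.pure_def, Multiset.bind_singleton]

theorem ModSymm.exists_dvd_add {W : Multiset ℕ} {d : ℕ} (h : ModSymm W d) {x : ℕ} (hx : x ∈ W) :
    ∃ y ∈ W, d ∣ x + y := by
  have hmem : (-(x : ZMod d)) ∈ W.map (fun x : ℕ => (x : ZMod d)) := by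
    rw [modSymm_iff.mp h]
    exact Multiset.mem_map_of_mem (fun x : ℕ => -(x : ZMod d)) hx
  obtain ⟨y, hy, hxy⟩ := Multiset.mem_map.mp hmem
  refine ⟨y, hy, (ZMod.natCast_eq_zero_iff _ _).mp ?_⟩
  push_cast
  rw [hxy, add_neg_cancel]

theorem Nat.eq_of_dvd_of_pos_of_lt_two_mul {d n : ℕ} (h : d ∣ n) (hn : 0 < n) (hlt : n < 2 * d) :
    n = d := by
  obtain ⟨c, rfl⟩ := h
  have hc : c < 2 := by
    by_contra! hc
    nlinarith
  have hc0 : c ≠ 0 := by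
    rintro rfl
    simp at hn
  obtain rfl : c = 1 := by omega
  exact mul_one d

/-- If every element of a bounded set of positive integers has, modulo each element of the set,
a negative in the set, then the set is stable under subtracting its minimum. -/
theorem sub_min_mem_of_exists_dvd_add {S : Set ℕ} {s A : ℕ} (hpos : ∀ x ∈ S, 0 < x)
    (hS : ∀ d ∈ S, ∀ x ∈ S, ∃ y ∈ S, d ∣ x + y) (hs : s ∈ S) (hmin : ∀ x ∈ S, s ≤ x)
    (hA : A ∈ S) (hmax : ∀ x ∈ S, x ≤ A) {r : ℕ} (hr : r ∈ S) (hsr : s < r) : r - s ∈ S := by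
  have hs0 := hpos s hs
  have hrefl : ∀ x ∈ S, x < A → A - x ∈ S := by
    intro x hx hxA
    obtain ⟨y, hy, hd⟩ := hS A hA x hx
    have := hmax y hy
    have := Nat.eq_of_dvd_of_pos_of_lt_two_mul hd (by have := hpos x hx; omega) (by omega)
    obtain rfl : y = A - x := by omega
    exact hy
  have hrA := hmax r hr
  have hb := hrefl s hs (by omega)
  rcases hrA.eq_or_lt with rfl | hrA
  · exact hb
  obtain ⟨z, hz, hd⟩ := hS _ hb _ (hrefl r hr hrA)
  have hsb := hmin _ hb
  by_cases hzA : z = A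
  · subst hzA
    have hd' : z - s ∣ z - r + s := by
      refine (Nat.dvd_add_right (dvd_refl (z - s))).mp ?_
      convert hd using 1
      omega
    have := Nat.eq_of_dvd_of_pos_of_lt_two_mul hd' (by omega) (by omega)
    obtain h : r - s = s := by omega
    rwa [h]
  · have hzA' : z < A := lt_of_le_of_ne (hmax z hz) hzA
    have := hmin _ (hrefl z hz hzA')
    have := Nat.eq_of_dvd_of_pos_of_lt_two_mul hd (by omega) (by omega)
    obtain rfl : z = r - s := by omega
    exact hz

theorem dvd_of_sub_min_mem {S : Set ℕ} {s : ℕ} (hpos : ∀ x ∈ S, 0 < x) (hs : s ∈ S)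
    (hmin : ∀ x ∈ S, s ≤ x) (hsub : ∀ x ∈ S, s < x → x - s ∈ S) {x : ℕ} (hx : x ∈ S) :
    s ∣ x := by
  induction x using Nat.strong_induction_on with
  | _ x ih =>
    rcases (hmin x hx).eq_or_lt with rfl | hlt
    · exact dvd_rfl
    · have := ih (x - s) (by have := hpos s hs; omega) (hsub x hx hlt)
      simpa [Nat.sub_add_cancel hlt.le] using dvd_add this (dvd_refl s)

/-- Lemma II, claim (1): under the stated hypotheses, `a i = i` for all `i`. -/
theorem stmt_2 (N : ℕ) (hN : 0 < N) (a m : ℕ → ℕ) (W : Multiset ℕ)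
    (hpos : ∀ i ∈ Finset.Icc 1 N, 0 < a i)
    (hmono : ∀ i ∈ Finset.Icc 1 N, ∀ k ∈ Finset.Icc 1 N, i < k → a i < a k)
    (hmult : ∀ i ∈ Finset.Icc 1 N, 1 ≤ m i)
    (hcount : ∀ i ∈ Finset.Icc 1 N, W.count (a i) = m i)
    (hmem : ∀ x ∈ W, ∃ i ∈ Finset.Icc 1 N, x = a i)
    (hgcd : (Finset.Icc 1 N).gcd a = 1)
    (hmod : ∀ i ∈ Finset.Icc 1 N, ModSymm W (a i)) :
    ∀ i ∈ Finset.Icc 1 N, a i = i := by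
  have haW : ∀ i ∈ Finset.Icc 1 N, a i ∈ W := fun i hi =>
    Multiset.count_pos.mp (by have := hcount i hi; have := hmult i hi; omega)
  have hstrict : StrictMonoOn a (Finset.Icc 1 N) := fun i hi k hk => hmono i hi k hk
  have h1 : 1 ∈ Finset.Icc 1 N := by simp; omega
  have hN' : N ∈ Finset.Icc 1 N := by simp; omega
  let S : Set ℕ := {x | x ∈ W}
  have hSpos : ∀ x ∈ S, 0 < x := by
    intro x hx
    obtain ⟨i, hi, rfl⟩ := hmem x hx
    exact hpos i hi
  have hSmin : ∀ x ∈ S, a 1 ≤ x := by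
    intro x hx
    obtain ⟨i, hi, rfl⟩ := hmem x hx
    exact hstrict.monotoneOn h1 hi (Finset.mem_Icc.mp hi).1
  have hSmax : ∀ x ∈ S, x ≤ a N := by
    intro x hx
    obtain ⟨i, hi, rfl⟩ := hmem x hx
    exact hstrict.monotoneOn hi hN' (Finset.mem_Icc.mp hi).2
  have hSneg : ∀ d ∈ S, ∀ x ∈ S, ∃ y ∈ S, d ∣ x + y := by
    intro d hd x hx
    obtain ⟨i, hi, rfl⟩ := hmem d hd
    exact (hmod i hi).exists_dvd_add hx
  have hsub : ∀ x ∈ S, a 1 < x → x - a 1 ∈ S := fun x hx =>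
    sub_min_mem_of_exists_dvd_add hSpos hSneg (haW 1 h1) hSmin (haW N hN') hSmax hx
  have hdvd : a 1 ∣ (Finset.Icc 1 N).gcd a := Finset.dvd_gcd fun i hi =>
    dvd_of_sub_min_mem hSpos (haW 1 h1) hSmin hsub (haW i hi)
  have ha1 : a 1 = 1 := Nat.dvd_one.mp (hdvd.trans hgcd.dvd)
  have hdown : ∀ x ∈ S, ∀ k, 1 ≤ k → k ≤ x → k ∈ S := by
    intro x hx k hk hkx
    induction x, hkx using Nat.le_induction with
    | base => exact hx
    | succ n hn ih =>
      refine ih ?_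
      have := hsub (n + 1) hx (by omega)
      rwa [ha1, Nat.add_sub_cancel] at this
  intro i hi
  have hiN := Finset.mem_Icc.mp hi
  have himage : (Finset.Icc 1 i).image a = Finset.Icc 1 (a i) := by
    ext x
    simp only [Finset.mem_image, Finset.mem_Icc]
    constructor
    · rintro ⟨k, hk, rfl⟩
      have hk' : k ∈ Finset.Icc 1 N := Finset.mem_Icc.mpr ⟨hk.1, hk.2.trans hiN.2⟩
      exact ⟨hpos k hk', hstrict.monotoneOn hk' hi hk.2⟩
    · rintro ⟨hx1, hxi⟩
      obtain ⟨k, hk, rfl⟩ := hmem x (hdown _ (haW i hi) x hx1 hxi)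
      exact ⟨k, ⟨(Finset.mem_Icc.mp hk).1, (hstrict.le_iff_le hk hi).mp hxi⟩, rfl⟩
  have hcard := congrArg Finset.card himage
  rw [Finset.card_image_of_injOn] at hcard
  · simpa using hcard.symm
  · refine hstrict.injOn.mono fun k hk => ?_
    simp only [Finset.coe_Icc, Set.mem_Icc] at hk ⊢
    omega
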